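/- Define H(τ,ρ) := 24 F(τ,ρ) − r(τ,ρ), where F(τ,ρ) = −(w^{1/2}/θ₄(τ)) ∑_{n∈ℤ} (−1)ⁿ q^{n²/2 − 1/8}/(1 − w q^{n−1/2}), w = e^{2πiρ}, and r(τ,ρ) = 4(θ₂(τ)² θ₂(τ,ρ)² + θ₃(τ)² θ₃(τ,ρ)²)/(θ₂(τ,ρ) θ₃(τ,ρ) θ₄(τ,ρ)). Then for every τ ∈ ℍ, as identities of meromorphic functions of ρ ∈ ℂ: r(τ,ρ+1) = −r(τ,ρ), r(τ,ρ+τ) = −e^{πiτ} e^{2πiρ} r(τ,ρ), H(τ,ρ+1) = −H(τ,ρ), H(τ,−ρ) = H(τ,ρ), and H(τ,ρ+τ) = −e^{πiτ} e^{2πiρ} H(τ,ρ) − 24 e^{(3/4)πiτ} e^{πiρ}. -/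

import Mathlib

open Complex

noncomputable section

/-- `e^{2πiτs}`, i.e. `q^s` for `q = e^{2πiτ}`. -/
def qp (τ s : ℂ) : ℂ := Complex.exp (2 * (Real.pi : ℂ) * Complex.I * τ * s)

/-- Jacobi theta function `θ₂(τ,v) = ∑_{r∈ℤ+1/2} q^{r²/2} e^{2πirv}`. -/
def theta2e (τ v : ℂ) : ℂ :=
  ∑' n : ℤ, qp τ (((n : ℂ) + 1 / 2) ^ 2 / 2) *
    Complex.exp (2 * (Real.pi : ℂ) * Complex.I * ((n : ℂ) + 1 / 2) * v)

/-- Jacobi theta function `θ₃(τ,v) = ∑_{n∈ℤ} q^{n²/2} e^{2πinv}`. -/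
def theta3e (τ v : ℂ) : ℂ :=
  ∑' n : ℤ, qp τ ((n : ℂ) ^ 2 / 2) *
    Complex.exp (2 * (Real.pi : ℂ) * Complex.I * (n : ℂ) * v)

/-- Jacobi theta function `θ₄(τ,v) = ∑_{n∈ℤ} (−1)ⁿ q^{n²/2} e^{2πinv}`. -/
def theta4e (τ v : ℂ) : ℂ :=
  ∑' n : ℤ, (-1 : ℂ) ^ n * qp τ ((n : ℂ) ^ 2 / 2) *
    Complex.exp (2 * (Real.pi : ℂ) * Complex.I * (n : ℂ) * v)

/-- Theta constant `θ₂(τ) = θ₂(τ,0)`. -/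
def theta2 (τ : ℂ) : ℂ := theta2e τ 0

/-- Theta constant `θ₃(τ) = θ₃(τ,0)`. -/
def theta3 (τ : ℂ) : ℂ := theta3e τ 0

/-- Theta constant `θ₄(τ) = θ₄(τ,0)`. -/
def theta4 (τ : ℂ) : ℂ := theta4e τ 0

/-- The mock Jacobi form
`F(τ,ρ) = −(w^{1/2}/θ₄(τ)) ∑_{n∈ℤ} (−1)ⁿ q^{n²/2−1/8}/(1 − w q^{n−1/2})`, `w = e^{2πiρ}`. -/
def Fe (τ ρ : ℂ) : ℂ :=
  -(Complex.exp ((Real.pi : ℂ) * Complex.I * ρ) / theta4 τ) *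
    ∑' n : ℤ, (-1 : ℂ) ^ n * qp τ ((n : ℂ) ^ 2 / 2 - 1 / 8) /
      (1 - Complex.exp (2 * (Real.pi : ℂ) * Complex.I * ρ) * qp τ ((n : ℂ) - 1 / 2))

/-- `r(τ,ρ) = 4(θ₂(τ)²θ₂(τ,ρ)² + θ₃(τ)²θ₃(τ,ρ)²)/(θ₂(τ,ρ)θ₃(τ,ρ)θ₄(τ,ρ))`. -/
def rJ (τ ρ : ℂ) : ℂ :=
  4 * (theta2 τ ^ 2 * theta2e τ ρ ^ 2 + theta3 τ ^ 2 * theta3e τ ρ ^ 2) /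
    (theta2e τ ρ * theta3e τ ρ * theta4e τ ρ)

/-- The mock Jacobi form `H(τ,ρ) = 24 F(τ,ρ) − r(τ,ρ)`. -/
def HJ (τ ρ : ℂ) : ℂ := 24 * Fe τ ρ - rJ τ ρ

lemma aux_exp_int (n : ℤ) : Complex.exp (2 * (Real.pi : ℂ) * Complex.I * (n : ℂ)) = 1 := by
  rw [Complex.exp_eq_one_iff]; exact ⟨n, by ring⟩

lemma theta2e_add_one (τ v : ℂ) : theta2e τ (v + 1) = -theta2e τ v := by
  unfold theta2e
  rw [← tsum_neg]
  refine tsum_congr fun n => ?_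
  have : 2 * (Real.pi : ℂ) * Complex.I * ((n : ℂ) + 1 / 2) * (v + 1) =
    2 * (Real.pi : ℂ) * Complex.I * ((n : ℂ) + 1 / 2) * v +
      2 * (Real.pi : ℂ) * Complex.I * (n : ℂ) + (Real.pi : ℂ) * Complex.I := by ring
  rw [this, Complex.exp_add, Complex.exp_add, aux_exp_int, Complex.exp_pi_mul_I]; ring

lemma theta3e_add_one (τ v : ℂ) : theta3e τ (v + 1) = theta3e τ v := by
  unfold theta3e
  refine tsum_congr fun n => ?_
  rw [mul_add, Complex.exp_add, mul_one, aux_exp_int, mul_one]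

lemma theta4e_add_one (τ v : ℂ) : theta4e τ (v + 1) = theta4e τ v := by
  unfold theta4e
  refine tsum_congr fun n => ?_
  rw [mul_add _ v, Complex.exp_add, mul_one, aux_exp_int, mul_one]

lemma theta2e_neg (τ v : ℂ) : theta2e τ (-v) = theta2e τ v := by
  unfold theta2e
  rw [← (Equiv.subLeft (-1 : ℤ)).tsum_eq]
  refine tsum_congr fun n => ?_
  simp only [Equiv.subLeft_apply]; push_cast
  congr 2 <;> ring

lemma theta3e_neg (τ v : ℂ) : theta3e τ (-v) = theta3e τ v := by
  unfold theta3e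
  rw [← (Equiv.neg ℤ).tsum_eq]
  refine tsum_congr fun n => ?_
  simp only [Equiv.neg_apply]; push_cast
  congr 2 <;> ring

lemma theta4e_neg (τ v : ℂ) : theta4e τ (-v) = theta4e τ v := by
  unfold theta4e
  rw [← (Equiv.neg ℤ).tsum_eq]
  refine tsum_congr fun n => ?_
  simp only [Equiv.neg_apply]; push_cast
  rw [zpow_neg, ← inv_zpow, inv_neg_one]
  congr 2 <;> ring_nf

/-- the multiplier -/
def aM (τ v : ℂ) : ℂ := Complex.exp (-((Real.pi : ℂ) * Complex.I * τ) - 2 * (Real.pi : ℂ) * Complex.I * v)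

lemma theta2e_add_tau (τ v : ℂ) : theta2e τ (v + τ) = aM τ v * theta2e τ v := by
  unfold theta2e
  rw [← tsum_mul_left, ← (Equiv.subRight (1 : ℤ)).tsum_eq]
  refine tsum_congr fun n => ?_
  simp only [Equiv.subRight_apply, qp, aM]; push_cast
  simp only [← Complex.exp_add]
  congr 1; ring

lemma theta3e_add_tau (τ v : ℂ) : theta3e τ (v + τ) = aM τ v * theta3e τ v := by
  unfold theta3e
  rw [← tsum_mul_left, ← (Equiv.subRight (1 : ℤ)).tsum_eq]
  refine tsum_congr fun n => ?_
  simp only [Equiv.subRight_apply, qp, aM]; push_cast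
  simp only [← Complex.exp_add]
  congr 1; ring

lemma theta4e_add_tau (τ v : ℂ) : theta4e τ (v + τ) = -aM τ v * theta4e τ v := by
  unfold theta4e
  rw [← tsum_mul_left, ← (Equiv.subRight (1 : ℤ)).tsum_eq]
  refine tsum_congr fun n => ?_
  simp only [Equiv.subRight_apply, qp, aM]; push_cast
  rw [zpow_sub_one₀ (by norm_num), inv_neg_one]
  have : ∀ s A B C D : ℂ, A * B = C * (D) → s * -1 * A * B = -C * (s * D) := by
    intro s A B C D h; linear_combination -s * h
  rw [mul_assoc ((-1:ℂ) ^ n) (Complex.exp _) (Complex.exp _)]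
  apply this
  simp only [← Complex.exp_add]
  congr 1; ring

lemma rJ_add_one (τ v : ℂ) : rJ τ (v + 1) = -rJ τ v := by
  unfold rJ
  rw [theta2e_add_one, theta3e_add_one, theta4e_add_one, neg_sq, neg_mul, neg_mul, div_neg]

lemma rJ_neg (τ v : ℂ) : rJ τ (-v) = rJ τ v := by
  unfold rJ
  rw [theta2e_neg, theta3e_neg, theta4e_neg]

lemma rJ_add_tau (τ v : ℂ) : rJ τ (v + τ) = -Complex.exp ((Real.pi : ℂ) * Complex.I * τ) *
        Complex.exp (2 * (Real.pi : ℂ) * Complex.I * v) * rJ τ v := by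
  have h : Complex.exp ((Real.pi : ℂ) * Complex.I * τ) *
        Complex.exp (2 * (Real.pi : ℂ) * Complex.I * v) = (aM τ v)⁻¹ := by
    rw [aM, ← Complex.exp_neg, ← Complex.exp_add]; congr 1; ring
  have h0 : aM τ v ≠ 0 := Complex.exp_ne_zero _
  rw [neg_mul, h]
  unfold rJ
  rw [theta2e_add_tau, theta3e_add_tau, theta4e_add_tau]
  have e1 : 4 * (theta2 τ ^ 2 * (aM τ v * theta2e τ v) ^ 2 + theta3 τ ^ 2 * (aM τ v * theta3e τ v) ^ 2)
    = aM τ v ^ 2 * (4 * (theta2 τ ^ 2 * theta2e τ v ^ 2 + theta3 τ ^ 2 * theta3e τ v ^ 2)) := by ring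
  have e2 : aM τ v * theta2e τ v * (aM τ v * theta3e τ v) * (-aM τ v * theta4e τ v)
    = (-aM τ v ^ 3) * (theta2e τ v * theta3e τ v * theta4e τ v) := by ring
  rw [e1, e2, mul_div_mul_comm]
  congr 1
  field_simp

/-! ### nonvanishing of theta4 -/

lemma theta4_eq (τ : ℂ) : theta4 τ = ∑' n : ℤ, (-1 : ℂ) ^ n * qp τ ((n : ℂ) ^ 2 / 2) := by
  simp [theta4, theta4e]

lemma summable_qp {τ : ℂ} (hτ : 0 < τ.im) : Summable fun n : ℤ => ‖qp τ ((n : ℂ) ^ 2 / 2)‖ := by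
  have := (hasSum_jacobiTheta₂_term 0 hτ).summable.norm
  refine this.congr fun n => ?_
  simp only [jacobiTheta₂_term, qp]
  congr 2; ring

lemma neg_one_zpow_norm (n : ℤ) : ‖(-1 : ℂ) ^ n‖ = 1 := by simp

lemma summable_qp4 {τ : ℂ} (hτ : 0 < τ.im) :
    Summable fun n : ℤ => ‖(-1 : ℂ) ^ n * qp τ ((n : ℂ) ^ 2 / 2)‖ := by
  simpa using summable_qp hτ

lemma theta4_eq_jacobi (τ : ℂ) : theta4 τ = jacobiTheta (τ + 1) := by
  rw [theta4_eq, jacobiTheta]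
  refine tsum_congr fun n => ?_
  have : (Real.pi : ℂ) * Complex.I * (n : ℂ) ^ 2 * (τ + 1) =
      ((n ^ 2 : ℤ) : ℂ) * ((Real.pi : ℂ) * Complex.I) + 2 * (Real.pi : ℂ) * Complex.I * τ * ((n : ℂ) ^ 2 / 2) := by
    push_cast; ring
  rw [this, Complex.exp_add, Complex.exp_int_mul, Complex.exp_pi_mul_I, qp]
  congr 1
  rcases Int.even_or_odd n with h | h
  · rw [h.neg_one_zpow, (h.pow_of_ne_zero (by norm_num)).neg_one_zpow]
  · rw [h.neg_one_zpow, h.pow.neg_one_zpow]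

lemma double_aux (u U : ℤ → ℂ) (hu : Summable fun n => ‖u n‖) 
    (hU : Summable fun n => ‖(-1 : ℂ) ^ n * U n‖) (hu' : Summable fun n => ‖(-1 : ℂ) ^ n * u n‖)
    (huU : ∀ a b : ℤ, u (a + b) * u (a - b) = U a * U b) :
    (∑' n, u n) * (∑' n, (-1 : ℂ) ^ n * u n) =
      (∑' n, (-1 : ℂ) ^ n * U n) * (∑' n, (-1 : ℂ) ^ n * U n) := by
  rw [tsum_mul_tsum_of_summable_norm hu hu', tsum_mul_tsum_of_summable_norm hU hU]
  have hS : Summable fun z : ℤ × ℤ => u z.1 * ((-1 : ℂ) ^ z.2 * u z.2) :=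
    summable_mul_of_summable_norm (f := u) (g := fun n => (-1 : ℂ) ^ n * u n) hu hu'
  have hS' : Summable fun z : ℤ × ℤ => u z.2 * ((-1 : ℂ) ^ z.1 * u z.1) :=
    (Equiv.prodComm ℤ ℤ).summable_iff.mpr hS
  have hsw : ∑' z : ℤ × ℤ, u z.2 * ((-1 : ℂ) ^ z.1 * u z.1) =
      ∑' z : ℤ × ℤ, u z.1 * ((-1 : ℂ) ^ z.2 * u z.2) :=
    (Equiv.prodComm ℤ ℤ).tsum_eq (fun z : ℤ × ℤ => u z.1 * ((-1 : ℂ) ^ z.2 * u z.2))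
  have key := hS.tsum_add hS'
  rw [hsw, ← two_mul] at key
  refine mul_left_cancel₀ (two_ne_zero (α := ℂ)) ?_
  rw [← key]
  have hg : Function.Injective (fun z : ℤ × ℤ => (z.1 + z.2, z.1 - z.2)) := by
    rintro ⟨a, b⟩ ⟨c, d⟩ h
    simp only [Prod.mk.injEq] at h ⊢
    omega
  rw [← hg.tsum_eq, ← tsum_mul_left]
  · refine tsum_congr fun z => ?_
    obtain ⟨a, b⟩ := z
    have e1 : (-1 : ℂ) ^ (a - b) = (-1) ^ a * (-1) ^ b := by
      rw [zpow_sub₀ (by norm_num), div_eq_mul_inv, ← inv_zpow, inv_neg_one]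
    have e2 : (-1 : ℂ) ^ (a + b) = (-1) ^ a * (-1) ^ b := by
      rw [zpow_add₀ (by norm_num)]
    have e3 := huU a b
    simp only []
    rw [e1, e2]
    linear_combination 2 * (-1 : ℂ) ^ a * (-1) ^ b * e3
  · rintro ⟨m, n⟩ h
    by_contra hc
    apply h
    have hodd : Odd (m + n) := by
      by_contra ho
      rw [Int.not_odd_iff_even] at ho
      obtain ⟨k, hk⟩ := ho
      apply hc
      refine ⟨(k, m - k), ?_⟩
      simp only [Prod.mk.injEq]; omega
    have e : (-1 : ℂ) ^ n + (-1) ^ m = 0 := by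
      rcases Int.even_or_odd n with h | h
      · have : Odd m := by
          rw [Int.odd_add] at hodd; exact hodd.mpr h
        rw [h.neg_one_zpow, this.neg_one_zpow]; ring
      · have : Even m := by
          rw [← Int.not_odd_iff_even]; intro h'
          rw [Int.odd_add] at hodd
          exact (Int.not_even_iff_odd.mpr h) (hodd.mp h')
        rw [h.neg_one_zpow, this.neg_one_zpow]; ring
    linear_combination (u m * u n) * e

lemma theta4_double {τ : ℂ} (hτ : 0 < τ.im) :
    (∑' n : ℤ, qp τ ((n : ℂ) ^ 2 / 2)) * theta4 τ = theta4 (2 * τ) ^ 2 := by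
  have hτ2 : 0 < (2 * τ).im := by simpa using hτ
  rw [sq, theta4_eq, theta4_eq]
  refine double_aux (fun n : ℤ => qp τ ((n : ℂ) ^ 2 / 2)) (fun n : ℤ => qp (2 * τ) ((n : ℂ) ^ 2 / 2))
    (summable_qp hτ) (summable_qp4 hτ2) (summable_qp4 hτ) fun a b => ?_
  simp only [qp, ← Complex.exp_add]; congr 1; push_cast; ring

lemma theta4_ne_zero {τ : ℂ} (hτ : 0 < τ.im) : theta4 τ ≠ 0 := by
  intro h0
  have hall : ∀ k : ℕ, theta4 (2 ^ k * τ) = 0 := by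
    intro k
    induction k with
    | zero => simpa using h0
    | succ k ih =>
      have him : 0 < ((2 : ℂ) ^ k * τ).im := by
        have : ((2 : ℂ) ^ k * τ).im = 2 ^ k * τ.im := by
          rw [show ((2 : ℂ) ^ k) = ((2 ^ k : ℝ) : ℂ) by push_cast; rfl, Complex.im_ofReal_mul]
        rw [this]; positivity
      have := theta4_double him
      rw [ih, mul_zero] at this
      rw [pow_succ', mul_assoc]
      exact pow_eq_zero_iff (two_ne_zero) |>.mp this.symm
  obtain ⟨k, hk⟩ := pow_unbounded_of_one_lt (1 / τ.im) (one_lt_two)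
  have him : (2 ^ k * τ + 1).im = 2 ^ k * τ.im := by
    rw [show ((2 : ℂ) ^ k) = ((2 ^ k : ℝ) : ℂ) by push_cast; rfl]
    rw [Complex.add_im, Complex.im_ofReal_mul, Complex.one_im, add_zero]
  have h1 : 1 < (2 ^ k * τ + 1).im := by
    rw [him]; rwa [div_lt_iff₀ hτ] at hk
  have hb := norm_jacobiTheta_sub_one_le (τ := 2 ^ k * τ + 1) (by linarith)
  rw [← theta4_eq_jacobi, hall k] at hb
  set t := (2 ^ k * τ + 1).im
  have hx : Real.exp (-Real.pi * t) < 1 / 4 := by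
    have : Real.exp (-Real.pi * t) ≤ Real.exp (-1) ^ 3 := by
      rw [← Real.exp_nat_mul, Real.exp_le_exp]
      have := Real.pi_gt_three
      push_cast; nlinarith
    have h2 : Real.exp (-1) < 1 / 2 := by
      have := Real.exp_neg_one_lt_d9; linarith
    have h3 := Real.exp_pos (-1)
    have : Real.exp (-1) ^ 3 < (1 / 2) ^ 3 := by gcongr
    linarith
  have hp := Real.exp_pos (-Real.pi * t)
  rw [zero_sub, norm_neg, norm_one, div_mul_eq_mul_div, le_div_iff₀ (by linarith)] at hb
  linarith

/-! ### the Appell sum -/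

lemma summable_S {τ : ℂ} (ρ : ℂ) (hτ : 0 < τ.im) :
    Summable fun n : ℤ => (-1 : ℂ) ^ n * qp τ ((n : ℂ) ^ 2 / 2 - 1 / 8) /
      (1 - Complex.exp (2 * (Real.pi : ℂ) * Complex.I * ρ) * qp τ ((n : ℂ) - 1 / 2)) := by
  have hn : ∀ n : ℤ, ‖Complex.exp (2 * (Real.pi : ℂ) * Complex.I * ρ) * qp τ ((n : ℂ) - 1 / 2)‖
      = Real.exp (-(2 * Real.pi * τ.im) * n + (-(2 * Real.pi * ρ.im) + Real.pi * τ.im)) := by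
    intro n
    rw [qp, ← Complex.exp_add, Complex.norm_exp]
    congr 1
    simp
    ring
  have hev : ∀ᶠ n : ℤ in Filter.cofinite,
      1 / 2 ≤ ‖1 - Complex.exp (2 * (Real.pi : ℂ) * Complex.I * ρ) * qp τ ((n : ℂ) - 1 / 2)‖ := by
    have hc : -(2 * Real.pi * τ.im) < 0 := by have := Real.pi_pos; simp; positivity
    rw [Int.cofinite_eq, Filter.eventually_sup]
    constructor
    · have : Filter.Tendsto (fun n : ℤ => Real.exp (-(2 * Real.pi * τ.im) * n + (-(2 * Real.pi * ρ.im) + Real.pi * τ.im))) Filter.atBot Filter.atTop := by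
        apply Real.tendsto_exp_atTop.comp
        apply Filter.tendsto_atTop_add_const_right
        exact (tendsto_intCast_atBot_iff (R := ℝ) |>.mpr Filter.tendsto_id).const_mul_atBot_of_neg hc
      filter_upwards [this.eventually_ge_atTop 2] with n h
      rw [← hn] at h
      have := norm_sub_norm_le (Complex.exp (2 * (Real.pi : ℂ) * Complex.I * ρ) * qp τ ((n : ℂ) - 1 / 2)) 1
      rw [norm_sub_rev, norm_one] at this
      linarith
    · have : Filter.Tendsto (fun n : ℤ => Real.exp (-(2 * Real.pi * τ.im) * n + (-(2 * Real.pi * ρ.im) + Real.pi * τ.im))) Filter.atTop (nhds 0) := by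
        apply Real.tendsto_exp_atBot.comp
        apply Filter.tendsto_atBot_add_const_right
        exact (tendsto_intCast_atTop_atTop (R := ℝ)).const_mul_atTop_of_neg hc
      filter_upwards [this.eventually_le_const (show (0:ℝ) < 1 / 2 by norm_num)] with n h
      rw [← hn] at h
      have := norm_sub_norm_le 1 (Complex.exp (2 * (Real.pi : ℂ) * Complex.I * ρ) * qp τ ((n : ℂ) - 1 / 2))
      rw [norm_one] at this
      linarith
  refine Summable.of_norm_bounded_eventually ((summable_qp hτ).mul_right (‖qp τ (-1 / 8)‖ * 2)) ?_
  filter_upwards [hev] with n h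
  have e : qp τ ((n : ℂ) ^ 2 / 2 - 1 / 8) = qp τ ((n : ℂ) ^ 2 / 2) * qp τ (-1 / 8) := by
    simp only [qp, ← Complex.exp_add]; congr 1; ring
  rw [norm_div, norm_mul, neg_one_zpow_norm, one_mul, e, norm_mul, div_le_iff₀ (by linarith)]
  have := mul_nonneg (norm_nonneg (qp τ ((n : ℂ) ^ 2 / 2))) (norm_nonneg (qp τ (-1 / 8)))
  nlinarith

lemma Fe_add_one (τ ρ : ℂ) : Fe τ (ρ + 1) = -Fe τ ρ := by
  unfold Fe
  have e1 : Complex.exp ((Real.pi : ℂ) * Complex.I * (ρ + 1)) = -Complex.exp ((Real.pi : ℂ) * Complex.I * ρ) := by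
    rw [mul_add, mul_one, Complex.exp_add, Complex.exp_pi_mul_I]; ring
  have e2 : Complex.exp (2 * (Real.pi : ℂ) * Complex.I * (ρ + 1)) = Complex.exp (2 * (Real.pi : ℂ) * Complex.I * ρ) := by
    rw [mul_add, mul_one, Complex.exp_add, Complex.exp_two_pi_mul_I, mul_one]
  rw [e1, e2]; ring

lemma Fe_neg (τ ρ : ℂ) (h1 : ∀ n : ℤ,
      1 - Complex.exp (2 * (Real.pi : ℂ) * Complex.I * ρ) * qp τ ((n : ℂ) - 1 / 2) ≠ 0) :
    Fe τ (-ρ) = Fe τ ρ := by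
  unfold Fe
  rw [← tsum_mul_left, ← tsum_mul_left, ← (Equiv.subLeft (1 : ℤ)).tsum_eq]
  refine tsum_congr fun n => ?_
  simp only [Equiv.subLeft_apply]
  have hz := h1 n
  have s : (-1 : ℂ) ^ (1 - n) = -(-1) ^ n := by
    rw [zpow_sub₀ (by norm_num), zpow_one, div_eq_mul_inv, ← inv_zpow, inv_neg_one]; ring
  set X := Complex.exp (2 * (Real.pi : ℂ) * Complex.I * ρ) * qp τ ((n : ℂ) - 1 / 2) with hX
  have hX0 : X ≠ 0 := by rw [hX]; exact mul_ne_zero (Complex.exp_ne_zero _) (Complex.exp_ne_zero _)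
  have e1 : Complex.exp (2 * (Real.pi : ℂ) * Complex.I * -ρ) * qp τ (((1 - n : ℤ) : ℂ) - 1 / 2) = X⁻¹ := by
    rw [hX]; simp only [qp, ← Complex.exp_add, ← Complex.exp_neg]; congr 1; push_cast; ring
  have e2 : Complex.exp ((Real.pi : ℂ) * Complex.I * -ρ) * qp τ (((1 - n : ℤ) : ℂ) ^ 2 / 2 - 1 / 8) * X
      = Complex.exp ((Real.pi : ℂ) * Complex.I * ρ) * qp τ ((n : ℂ) ^ 2 / 2 - 1 / 8) := by
    rw [hX]; simp only [qp, ← Complex.exp_add]; congr 1; push_cast; ring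
  rw [e1, s]
  have hz' : 1 - X⁻¹ = -(1 - X) / X := by field_simp; ring
  rw [hz', neg_div, div_neg, div_div_eq_mul_div]
  linear_combination (-((-1) ^ n) / theta4 τ / (1 - X)) * e2

lemma Fe_add_tau (τ ρ : ℂ) (hτ : 0 < τ.im) (h1 : ∀ n : ℤ,
      1 - Complex.exp (2 * (Real.pi : ℂ) * Complex.I * ρ) * qp τ ((n : ℂ) - 1 / 2) ≠ 0) :
    Fe τ (ρ + τ) = -Complex.exp ((Real.pi : ℂ) * Complex.I * τ) *
          Complex.exp (2 * (Real.pi : ℂ) * Complex.I * ρ) * Fe τ ρ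
        - Complex.exp ((3 / 4 : ℂ) * (Real.pi : ℂ) * Complex.I * τ) *
            Complex.exp ((Real.pi : ℂ) * Complex.I * ρ) := by
  have h4 := theta4_ne_zero hτ
  have hs := summable_S ρ hτ
  have hT : ∑' n : ℤ, (-1 : ℂ) ^ n * qp τ ((n : ℂ) ^ 2 / 2 - 1 / 8) /
      (1 - Complex.exp (2 * (Real.pi : ℂ) * Complex.I * (ρ + τ)) * qp τ ((n : ℂ) - 1 / 2)) =
      qp τ (-1 / 8) * theta4 τ - Complex.exp (2 * (Real.pi : ℂ) * Complex.I * ρ) *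
      ∑' n : ℤ, (-1 : ℂ) ^ n * qp τ ((n : ℂ) ^ 2 / 2 - 1 / 8) /
      (1 - Complex.exp (2 * (Real.pi : ℂ) * Complex.I * ρ) * qp τ ((n : ℂ) - 1 / 2)) := by
    have hs4 : Summable fun n : ℤ => (-1 : ℂ) ^ (n - 1) * qp τ (((n - 1 : ℤ) : ℂ) ^ 2 / 2) :=
      (Equiv.subRight (1 : ℤ)).summable_iff.mpr (summable_qp4 hτ).of_norm
    have ht4 : theta4 τ = ∑' n : ℤ, (-1 : ℂ) ^ (n - 1) * qp τ (((n - 1 : ℤ) : ℂ) ^ 2 / 2) := by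
      rw [theta4_eq, ← (Equiv.subRight (1 : ℤ)).tsum_eq]; rfl
    rw [ht4, ← tsum_mul_left, ← tsum_mul_left, ← (hs4.mul_left _).tsum_sub (hs.mul_left _),
      ← (Equiv.subRight (1 : ℤ)).tsum_eq]
    refine tsum_congr fun n => ?_
    simp only [Equiv.subRight_apply]
    have hz := h1 n
    set w := Complex.exp (2 * (Real.pi : ℂ) * Complex.I * ρ) with hw
    have e1 : Complex.exp (2 * (Real.pi : ℂ) * Complex.I * (ρ + τ)) * qp τ (((n - 1 : ℤ) : ℂ) - 1 / 2)
        = w * qp τ ((n : ℂ) - 1 / 2) := by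
      rw [hw]; simp only [qp, ← Complex.exp_add]; congr 1; push_cast; ring
    have e2 : qp τ (((n - 1 : ℤ) : ℂ) ^ 2 / 2 - 1 / 8) = qp τ (-1 / 8) * qp τ (((n - 1 : ℤ) : ℂ) ^ 2 / 2) := by
      simp only [qp, ← Complex.exp_add]; congr 1; ring
    have e3 : qp τ ((n : ℂ) ^ 2 / 2 - 1 / 8) =
        qp τ (-1 / 8) * qp τ (((n - 1 : ℤ) : ℂ) ^ 2 / 2) * qp τ ((n : ℂ) - 1 / 2) := by
      simp only [qp, ← Complex.exp_add]; congr 1; push_cast; ring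
    rw [e1, e2, e3, zpow_sub_one₀ (by norm_num), inv_neg_one]
    generalize qp τ ((n : ℂ) - 1 / 2) = x at hz ⊢
    generalize qp τ (((n - 1 : ℤ) : ℂ) ^ 2 / 2) = y
    field_simp
    ring
  unfold Fe
  rw [hT]
  have e1 : Complex.exp ((Real.pi : ℂ) * Complex.I * (ρ + τ)) =
    Complex.exp ((Real.pi : ℂ) * Complex.I * ρ) * Complex.exp ((Real.pi : ℂ) * Complex.I * τ) := by
    rw [← Complex.exp_add]; congr 1; ring
  have e2 : Complex.exp ((3 / 4 : ℂ) * (Real.pi : ℂ) * Complex.I * τ) =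
      Complex.exp ((Real.pi : ℂ) * Complex.I * τ) * qp τ (-1 / 8) := by
    rw [qp, ← Complex.exp_add]; congr 1; ring
  rw [e1, e2]
  field_simp
  ring

/-- Quasi-periodicity and symmetry of `r` and `H`: for every `τ ∈ ℍ`, wherever
everything is defined, `r(τ,ρ+1) = −r(τ,ρ)`, `r(τ,ρ+τ) = −e^{πiτ}e^{2πiρ} r(τ,ρ)`,
`H(τ,ρ+1) = −H(τ,ρ)`, `H(τ,−ρ) = H(τ,ρ)`, and
`H(τ,ρ+τ) = −e^{πiτ}e^{2πiρ} H(τ,ρ) − 24 e^{(3/4)πiτ} e^{πiρ}`. -/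
theorem r_H_quasiperiodic (τ ρ : ℂ) (hτ : 0 < τ.im)
    (h1 : ∀ n : ℤ,
      1 - Complex.exp (2 * (Real.pi : ℂ) * Complex.I * ρ) * qp τ ((n : ℂ) - 1 / 2) ≠ 0)
    (h2 : theta2e τ ρ ≠ 0) (h3 : theta3e τ ρ ≠ 0) (h4 : theta4e τ ρ ≠ 0) :
    rJ τ (ρ + 1) = -rJ τ ρ ∧
    rJ τ (ρ + τ) =
      -Complex.exp ((Real.pi : ℂ) * Complex.I * τ) *
        Complex.exp (2 * (Real.pi : ℂ) * Complex.I * ρ) * rJ τ ρ ∧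
    HJ τ (ρ + 1) = -HJ τ ρ ∧
    HJ τ (-ρ) = HJ τ ρ ∧
    HJ τ (ρ + τ) =
      -Complex.exp ((Real.pi : ℂ) * Complex.I * τ) *
          Complex.exp (2 * (Real.pi : ℂ) * Complex.I * ρ) * HJ τ ρ
        - 24 * Complex.exp ((3 / 4 : ℂ) * (Real.pi : ℂ) * Complex.I * τ) *
            Complex.exp ((Real.pi : ℂ) * Complex.I * ρ) := by
  refine ⟨rJ_add_one τ ρ, rJ_add_tau τ ρ, ?_, ?_, ?_⟩
  · unfold HJ; rw [Fe_add_one, rJ_add_one]; ring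
  · unfold HJ; rw [Fe_neg τ ρ h1, rJ_neg]
  · unfold HJ; rw [Fe_add_tau τ ρ hτ h1, rJ_add_tau]; ring
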